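/- Let n ≥ 2, R > 0, and let B = { x ∈ ℝⁿ : |x| < R }. Let a : ℝⁿ → ℝ and f : ℝⁿ → ℝ be smooth functions supported in the closed ball { |x| ≤ R }, and suppose sup_{x} |a(x)| < π / (2R). If for every x ∈ ℝⁿ and every unit vector θ ∈ ℝⁿ one has ∫_{−∞}^{∞} f(x + tθ) · exp( ∫₀ᵗ a(x + sθ) ds ) dt = 0, then f = 0. -/

import Mathlib

open RealInnerProductSpace
noncomputable section

theorem contDiff_parametric_unitInterval_nat {H : Type} [NormedAddCommGroup H] [NormedSpace ℝ H]
    [ProperSpace H] (n : ℕ) : ∀ {G : Type} [NormedAddCommGroup G] [NormedSpace ℝ G]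
    [CompleteSpace G] {g : H × ℝ → G}, ContDiff ℝ n g →
      ContDiff ℝ n fun x => ∫ s in (0 : ℝ)..1, g (x, s) := by
  induction n with
  | zero =>
    intro G _ _ _ g hg
    have hg' : Continuous g := hg.continuous
    exact contDiff_zero.2
      (intervalIntegral.continuous_parametric_intervalIntegral_of_continuous'
        (f := fun x s => g (x, s)) hg' 0 1)
  | succ n ih =>
    intro G _ _ _ g hg
    have hg1 : ContDiff ℝ 1 g := hg.of_le (by exact_mod_cast Nat.le_add_left 1 n)
    let g' : H × ℝ → H →L[ℝ] G := fun z => (fderiv ℝ g z).comp (ContinuousLinearMap.inl ℝ H ℝ)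
    have hg' : ContDiff ℝ n g' :=
      (hg.fderiv_right (m := n) (by norm_cast)).clm_comp contDiff_const
    have hder : ∀ x s, HasFDerivAt (fun y => g (y, s)) (g' (x, s)) x := fun x s =>
      ((hg1.differentiable one_ne_zero (x, s)).hasFDerivAt).comp x (hasFDerivAt_prodMk_left x s)
    have key : ∀ x, HasFDerivAt (fun x => ∫ s in (0 : ℝ)..1, g (x, s))
        (∫ s in (0 : ℝ)..1, g' (x, s)) x := by
      intro x
      obtain ⟨M, hM⟩ := ((isCompact_closedBall x 1).prod
        (isCompact_Icc (a := (0 : ℝ)) (b := 1))).exists_bound_of_continuousOn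
          hg'.continuous.continuousOn
      refine (intervalIntegral.hasFDerivAt_integral_of_dominated_of_fderiv_le
        (bound := fun _ => M) (F' := fun x s => g' (x, s))
        (Metric.closedBall_mem_nhds x one_pos) ?_ ?_ ?_ ?_ ?_ ?_)
      · exact Filter.Eventually.of_forall fun y =>
          (hg.continuous.comp (by fun_prop)).aestronglyMeasurable
      · exact (hg.continuous.comp (by fun_prop)).intervalIntegrable _ _
      · exact (hg'.continuous.comp (by fun_prop)).aestronglyMeasurable
      · refine Filter.Eventually.of_forall fun s hs y hy => hM (y, s) ⟨hy, ?_⟩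
        rw [Set.uIoc_of_le zero_le_one] at hs
        exact ⟨hs.1.le, hs.2⟩
      · exact intervalIntegrable_const
      · exact Filter.Eventually.of_forall fun s _ y _ => hder y s
    have hfd : (fderiv ℝ fun x => ∫ s in (0 : ℝ)..1, g (x, s)) =
        fun x => ∫ s in (0 : ℝ)..1, g' (x, s) := funext fun x => (key x).fderiv
    push_cast
    refine contDiff_succ_iff_fderiv.2 ⟨fun x => (key x).differentiableAt, by simp, ?_⟩
    rw [hfd]
    exact ih hg'

theorem contDiff_parametric_unitInterval {H G : Type} [NormedAddCommGroup H] [NormedSpace ℝ H]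
    [ProperSpace H] [NormedAddCommGroup G] [NormedSpace ℝ G] [CompleteSpace G] {g : H × ℝ → G}
    (hg : ContDiff ℝ (⊤ : ℕ∞) g) :
    ContDiff ℝ (⊤ : ℕ∞) fun x => ∫ s in (0 : ℝ)..1, g (x, s) :=
  contDiff_infty.2 fun n => contDiff_parametric_unitInterval_nat n (contDiff_infty.1 hg n)

/-- The partial derivative of `g` in the `i`-th coordinate direction. -/
def partialDeriv (i : Fin 3) (g : (Fin 3 → ℝ) → ℝ) (p : Fin 3 → ℝ) : ℝ :=
  fderiv ℝ g p (Pi.single i 1)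

theorem ContDiff.partialDeriv {g : (Fin 3 → ℝ) → ℝ} (hg : ContDiff ℝ (⊤ : ℕ∞) g) (i : Fin 3) :
    ContDiff ℝ (⊤ : ℕ∞) (partialDeriv i g) :=
  (hg.fderiv_right (m := (⊤ : ℕ∞)) (by norm_cast)).clm_apply contDiff_const

theorem ContDiff.differentiableAt_top {g : (Fin 3 → ℝ) → ℝ} (hg : ContDiff ℝ (⊤ : ℕ∞) g)
    (p : Fin 3 → ℝ) : DifferentiableAt ℝ g p :=
  hg.differentiable (by norm_num) p

theorem partialDeriv_mul {g h : (Fin 3 → ℝ) → ℝ} {p : Fin 3 → ℝ} (i : Fin 3)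
    (hg : DifferentiableAt ℝ g p) (hh : DifferentiableAt ℝ h p) :
    partialDeriv i (fun q => g q * h q) p =
      partialDeriv i g p * h p + g p * partialDeriv i h p := by
  simp only [partialDeriv, fderiv_fun_mul hg hh]
  simp
  ring

theorem partialDeriv_add {g h : (Fin 3 → ℝ) → ℝ} {p : Fin 3 → ℝ} (i : Fin 3)
    (hg : DifferentiableAt ℝ g p) (hh : DifferentiableAt ℝ h p) :
    partialDeriv i (fun q => g q + h q) p = partialDeriv i g p + partialDeriv i h p := by
  simp only [partialDeriv, fderiv_fun_add hg hh]
  simp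

theorem partialDeriv_sub {g h : (Fin 3 → ℝ) → ℝ} {p : Fin 3 → ℝ} (i : Fin 3)
    (hg : DifferentiableAt ℝ g p) (hh : DifferentiableAt ℝ h p) :
    partialDeriv i (fun q => g q - h q) p = partialDeriv i g p - partialDeriv i h p := by
  simp only [partialDeriv, fderiv_fun_sub hg hh]
  simp

theorem partialDeriv_comm {g : (Fin 3 → ℝ) → ℝ} (hg : ContDiff ℝ (⊤ : ℕ∞) g) (i j : Fin 3)
    (p : Fin 3 → ℝ) :
    partialDeriv i (partialDeriv j g) p = partialDeriv j (partialDeriv i g) p := by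
  have hd : DifferentiableAt ℝ (fderiv ℝ g) p :=
    (hg.fderiv_right (m := (⊤ : ℕ∞)) (by norm_cast)).differentiable (by norm_num) p
  have key : ∀ v w, fderiv ℝ (fun q => fderiv ℝ g q v) p w = fderiv ℝ (fderiv ℝ g) p w v := by
    intro v w
    rw [fderiv_clm_apply hd (differentiableAt_const v)]
    simp
  have hs : IsSymmSndFDerivAt ℝ g p := hg.contDiffAt.isSymmSndFDerivAt
    (by simpa using (by exact_mod_cast le_top : ((2 : ℕ∞) : WithTop ℕ∞) ≤ ((⊤ : ℕ∞) : WithTop ℕ∞)))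
  change fderiv ℝ (fun q => fderiv ℝ g q _) p _ = fderiv ℝ (fun q => fderiv ℝ g q _) p _
  rw [key, key]
  exact hs _ _

theorem eventually_outside_cylinder {R : ℝ} {p : Fin 3 → ℝ} (hp : R ^ 2 < p 0 ^ 2 + p 1 ^ 2) :
    ∀ᶠ q : Fin 3 → ℝ in nhds p, R ^ 2 < q 0 ^ 2 + q 1 ^ 2 :=
  (isOpen_lt continuous_const (by fun_prop)).mem_nhds hp

theorem partialDeriv_eq_zero_outside {R : ℝ} {g : (Fin 3 → ℝ) → ℝ}
    (hg : ∀ p, R ^ 2 < p 0 ^ 2 + p 1 ^ 2 → g p = 0) (i : Fin 3) (p : Fin 3 → ℝ)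
    (hp : R ^ 2 < p 0 ^ 2 + p 1 ^ 2) : partialDeriv i g p = 0 := by
  have : g =ᶠ[nhds p] fun _ => 0 := by
    filter_upwards [eventually_outside_cylinder hp] with q hq using hg q hq
  simp [partialDeriv, this.fderiv_eq]

theorem hasFDerivAt_coord (i : Fin 3) (p : Fin 3 → ℝ) :
    HasFDerivAt (fun q : Fin 3 → ℝ => q i) (ContinuousLinearMap.proj (R := ℝ) (φ := fun _ => ℝ) i)
      p :=
  (ContinuousLinearMap.proj (R := ℝ) (φ := fun _ : Fin 3 => ℝ) i).hasFDerivAt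

theorem partialDeriv_cos (i : Fin 3) (p : Fin 3 → ℝ) :
    partialDeriv i (fun q => Real.cos (q 2)) p = if i = 2 then -Real.sin (p 2) else 0 := by
  rw [partialDeriv, (hasFDerivAt_coord 2 p).cos.fderiv]
  fin_cases i <;> simp

theorem partialDeriv_sin (i : Fin 3) (p : Fin 3 → ℝ) :
    partialDeriv i (fun q => Real.sin (q 2)) p = if i = 2 then Real.cos (p 2) else 0 := by
  rw [partialDeriv, (hasFDerivAt_coord 2 p).sin.fderiv]
  fin_cases i <;> simp

theorem contDiff_cos_coord : ContDiff ℝ (⊤ : ℕ∞) fun q : Fin 3 → ℝ => Real.cos (q 2) := by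
  fun_prop

theorem contDiff_sin_coord : ContDiff ℝ (⊤ : ℕ∞) fun q : Fin 3 → ℝ => Real.sin (q 2) := by
  fun_prop

/-- The position along the oriented line through `(p 0, p 1)` with direction angle `p 2`. -/
def lineCoord (p : Fin 3 → ℝ) : ℝ := p 0 * Real.cos (p 2) + p 1 * Real.sin (p 2)

theorem contDiff_lineCoord : ContDiff ℝ (⊤ : ℕ∞) lineCoord := by
  unfold lineCoord
  fun_prop

theorem lineCoord_sq_le (p : Fin 3 → ℝ) : lineCoord p ^ 2 ≤ p 0 ^ 2 + p 1 ^ 2 := by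
  unfold lineCoord
  nlinarith [sq_nonneg (p 0 * Real.sin (p 2) - p 1 * Real.cos (p 2)),
    Real.sin_sq_add_cos_sq (p 2)]

theorem cos_mul_lineCoord_pos {R c : ℝ} (hR : 0 < R) (hc : 0 ≤ c) (hcR : c * R < Real.pi / 2)
    {p : Fin 3 → ℝ} (hp : p 0 ^ 2 + p 1 ^ 2 ≤ R ^ 2) : 0 < Real.cos (c * lineCoord p) := by
  have h := abs_le.1 (abs_le_of_sq_le_sq ((lineCoord_sq_le p).trans hp) hR.le)
  refine Real.cos_pos_of_mem_Ioo ⟨?_, ?_⟩ <;> nlinarith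

theorem partialDeriv_lineCoord (p : Fin 3 → ℝ) :
    partialDeriv 0 lineCoord p = Real.cos (p 2) ∧ partialDeriv 1 lineCoord p = Real.sin (p 2) := by
  have h := (((hasFDerivAt_coord 0 p).mul (hasFDerivAt_coord 2 p).cos).add
    ((hasFDerivAt_coord 1 p).mul (hasFDerivAt_coord 2 p).sin))
  have h' : HasFDerivAt lineCoord _ p := h
  constructor <;> · rw [partialDeriv, h'.fderiv]; simp

/-- The weight `c tan (c s) w²` whose derivative along lines yields the Poincaré inequality. -/
def tanWeight (c : ℝ) (w : (Fin 3 → ℝ) → ℝ) (p : Fin 3 → ℝ) : ℝ :=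
  c * Real.tan (c * lineCoord p) * w p ^ 2

theorem contDiff_tanWeight {R c : ℝ} (hR : 0 < R) (hc : 0 ≤ c) (hcR : c * R < Real.pi / 2)
    {w : (Fin 3 → ℝ) → ℝ} (hw : ContDiff ℝ (⊤ : ℕ∞) w)
    (hw0 : ∀ p, R ^ 2 < p 0 ^ 2 + p 1 ^ 2 → w p = 0) :
    ContDiff ℝ (⊤ : ℕ∞) (tanWeight c w) := by
  refine contDiff_iff_contDiffAt.2 fun p => ?_
  rcases le_or_gt (p 0 ^ 2 + p 1 ^ 2) (R ^ 2) with hp | hp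
  · have h := (cos_mul_lineCoord_pos hR hc hcR hp).ne'
    have htan : ContDiffAt ℝ (⊤ : ℕ∞) (fun q => Real.tan (c * lineCoord q)) p :=
      ContDiffAt.comp (g := Real.tan) (f := fun q => c * lineCoord q) p
        (Real.contDiffAt_tan.2 h) (contDiff_const.mul contDiff_lineCoord).contDiffAt
    exact (contDiffAt_const.mul htan).mul (hw.contDiffAt.pow 2)
  · refine (contDiffAt_const (c := (0 : ℝ))).congr_of_eventuallyEq ?_
    filter_upwards [eventually_outside_cylinder hp] with q hq
    simp [tanWeight, hw0 q hq]

theorem partialDeriv_tanWeight {R c : ℝ} (hR : 0 < R) (hc : 0 ≤ c) (hcR : c * R < Real.pi / 2)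
    {w : (Fin 3 → ℝ) → ℝ} (hw : ContDiff ℝ (⊤ : ℕ∞) w)
    (hw0 : ∀ p, R ^ 2 < p 0 ^ 2 + p 1 ^ 2 → w p = 0) (i : Fin 3) (p : Fin 3 → ℝ) :
    partialDeriv i (tanWeight c w) p =
      (c ^ 2 + (c * Real.tan (c * lineCoord p)) ^ 2) * partialDeriv i lineCoord p * w p ^ 2 +
        2 * (c * Real.tan (c * lineCoord p)) * w p * partialDeriv i w p := by
  rcases le_or_gt (p 0 ^ 2 + p 1 ^ 2) (R ^ 2) with hp | hp
  · have h := (cos_mul_lineCoord_pos hR hc hcR hp).ne'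
    have hl : HasFDerivAt (fun q => c * lineCoord q) (c • fderiv ℝ lineCoord p) p :=
      (contDiff_lineCoord.differentiableAt_top p).hasFDerivAt.const_mul c
    have ht : HasFDerivAt (fun q => Real.tan (c * lineCoord q))
        ((1 / Real.cos (c * lineCoord p) ^ 2) • (c • fderiv ℝ lineCoord p)) p :=
      HasDerivAt.comp_hasFDerivAt (h₂ := Real.tan) p (Real.hasDerivAt_tan h) hl
    have hG : HasFDerivAt (tanWeight c w) _ p :=
      (ht.const_mul c).mul ((hw.differentiableAt_top p).hasFDerivAt.pow 2)
    have hsec : 1 / Real.cos (c * lineCoord p) ^ 2 = 1 + Real.tan (c * lineCoord p) ^ 2 := by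
      rw [Real.tan_eq_sin_div_cos]
      field_simp
      linarith [Real.sin_sq_add_cos_sq (c * lineCoord p)]
    rw [partialDeriv, hG.fderiv, hsec]
    simp [partialDeriv]
    ring
  · have h0 : ∀ q : Fin 3 → ℝ, R ^ 2 < q 0 ^ 2 + q 1 ^ 2 → tanWeight c w q = 0 := fun q hq => by
      simp [tanWeight, hw0 q hq]
    rw [partialDeriv_eq_zero_outside h0 i p hp, hw0 p hp]
    ring

theorem sum_partialDeriv_integral_eq_zero {R : ℝ} (hR : 0 < R) {F : Fin 3 → (Fin 3 → ℝ) → ℝ}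
    (hF : ∀ i, ContDiff ℝ (⊤ : ℕ∞) (F i))
    (hF0 : ∀ i p, R ^ 2 < p 0 ^ 2 + p 1 ^ 2 → F i p = 0)
    (hper : ∀ p, F 2 (p + Pi.single 2 (2 * Real.pi)) = F 2 p) :
    ∫ p in Set.Icc (![-(R + 1), -(R + 1), 0] : Fin 3 → ℝ) ![R + 1, R + 1, 2 * Real.pi],
      ∑ i, partialDeriv i (F i) p = 0 := by
  have hle : (![-(R + 1), -(R + 1), 0] : Fin 3 → ℝ) ≤ ![R + 1, R + 1, 2 * Real.pi] := by
    intro i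
    fin_cases i
    · change -(R + 1) ≤ R + 1
      linarith
    · change -(R + 1) ≤ R + 1
      linarith
    · change (0 : ℝ) ≤ 2 * Real.pi
      positivity
  have hcont : Continuous fun p => ∑ i, partialDeriv i (F i) p :=
    continuous_finsetSum _ fun i _ => ((hF i).partialDeriv i).continuous
  have hdiv := MeasureTheory.integral_divergence_of_hasFDerivAt_off_countable' _ _ hle F
    (fun i p => fderiv ℝ (F i) p) ∅ Set.countable_empty (fun i => (hF i).continuous.continuousOn)
    (fun p _ i => ((hF i).differentiableAt_top p).hasFDerivAt)
    (hcont.integrableOn_Icc)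
  refine hdiv.trans (Finset.sum_eq_zero fun i _ => ?_)
  rw [sub_eq_zero]
  congr 1
  funext x
  have hout : ∀ s : ℝ, s ^ 2 = (R + 1) ^ 2 → ∀ j : Fin 3, j ≠ 2 → F j (j.insertNth s x) = 0 := by
    intro s hs j hj
    refine hF0 j _ ?_
    have hj1 : (j.insertNth s x : Fin 3 → ℝ) j ^ 2 = (R + 1) ^ 2 := by simp [hs]
    generalize (j.insertNth s x : Fin 3 → ℝ) = q at hj1 ⊢
    fin_cases j
    · change q 0 ^ 2 = (R + 1) ^ 2 at hj1
      nlinarith [sq_nonneg (q 1)]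
    · change q 1 ^ 2 = (R + 1) ^ 2 at hj1
      nlinarith [sq_nonneg (q 0)]
    · exact absurd rfl hj
  by_cases hi : i = 2
  · subst hi
    have : ((2 : Fin 3).insertNth ((![-(R + 1), -(R + 1), 0] : Fin 3 → ℝ) 2) x : Fin 3 → ℝ) +
        Pi.single 2 (2 * Real.pi) =
        (2 : Fin 3).insertNth ((![R + 1, R + 1, 2 * Real.pi] : Fin 3 → ℝ) 2) x := by
      rw [Fin.eq_insertNth_iff]
      refine ⟨by simp, ?_⟩
      funext j
      simp [Fin.removeNth]
    rw [← this, hper]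
  · rw [hout _ ?_ i hi, hout _ ?_ i hi]
    · fin_cases i
      · change (-(R + 1)) ^ 2 = (R + 1) ^ 2
        ring
      · change (-(R + 1)) ^ 2 = (R + 1) ^ 2
        ring
      · exact absurd rfl hi
    · fin_cases i
      · rfl
      · rfl
      · exact absurd rfl hi

/-- The geodesic vector field `cos θ ∂₀ + sin θ ∂₁` applied to `u`. -/
def lineDerivField (u : (Fin 3 → ℝ) → ℝ) (p : Fin 3 → ℝ) : ℝ :=
  Real.cos (p 2) * partialDeriv 0 u p + Real.sin (p 2) * partialDeriv 1 u p

theorem ContDiff.lineDerivField {u : (Fin 3 → ℝ) → ℝ} (hu : ContDiff ℝ (⊤ : ℕ∞) u) :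
    ContDiff ℝ (⊤ : ℕ∞) (lineDerivField u) :=
  (contDiff_cos_coord.mul (hu.partialDeriv 0)).add (contDiff_sin_coord.mul (hu.partialDeriv 1))

theorem lineDerivField_eq_zero_outside {R : ℝ} {u : (Fin 3 → ℝ) → ℝ}
    (hu : ∀ p, R ^ 2 < p 0 ^ 2 + p 1 ^ 2 → u p = 0) (p : Fin 3 → ℝ)
    (hp : R ^ 2 < p 0 ^ 2 + p 1 ^ 2) : lineDerivField u p = 0 := by
  simp [lineDerivField, partialDeriv_eq_zero_outside hu _ p hp]

theorem partialDeriv_add_period {u : (Fin 3 → ℝ) → ℝ} {v : Fin 3 → ℝ}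
    (hper : ∀ p, u (p + v) = u p) (i : Fin 3) (p : Fin 3 → ℝ) :
    partialDeriv i u (p + v) = partialDeriv i u p := by
  have h : (fun q => u (q + v)) = u := funext hper
  rw [partialDeriv, ← fderiv_comp_add_right, h, partialDeriv]

/-- Injectivity from the Pestov identity: an angularly periodic, compactly supported `u` with
`∂_θ X u = -A ∂_θ u` and `|A| ≤ c < π / (2 R)` is constant along lines. -/
theorem lineDerivField_eq_zero {R c : ℝ} (hR : 0 < R) (hc : 0 ≤ c) (hcR : c * R < Real.pi / 2)
    {u A : (Fin 3 → ℝ) → ℝ} (hu : ContDiff ℝ (⊤ : ℕ∞) u)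
    (hu0 : ∀ p, R ^ 2 < p 0 ^ 2 + p 1 ^ 2 → u p = 0)
    (hper : ∀ p, u (p + Pi.single 2 (2 * Real.pi)) = u p) (hA : ∀ p, |A p| ≤ c)
    (hV : ∀ p, partialDeriv 2 (lineDerivField u) p = -A p * partialDeriv 2 u p) (p : Fin 3 → ℝ)
    (hp0 : 0 < p 2) (hp1 : p 2 < 2 * Real.pi) : lineDerivField u p = 0 := by
  set W := partialDeriv 2 u
  set u₀ := partialDeriv 0 u with hu₀def
  set u₁ := partialDeriv 1 u with hu₁def
  have hW : ContDiff ℝ (⊤ : ℕ∞) W := hu.partialDeriv 2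
  have hu₀ : ContDiff ℝ (⊤ : ℕ∞) u₀ := hu.partialDeriv 0
  have hu₁ : ContDiff ℝ (⊤ : ℕ∞) u₁ := hu.partialDeriv 1
  have hW0 : ∀ q, R ^ 2 < q 0 ^ 2 + q 1 ^ 2 → W q = 0 := partialDeriv_eq_zero_outside hu0 2
  have hT : ContDiff ℝ (⊤ : ℕ∞) (tanWeight c W) := contDiff_tanWeight hR hc hcR hW hW0
  have hX := hu.lineDerivField
  let Y : (Fin 3 → ℝ) → ℝ := fun q => Real.cos (q 2) * u₁ q - Real.sin (q 2) * u₀ q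
  have hY : ContDiff ℝ (⊤ : ℕ∞) Y :=
    (contDiff_cos_coord.mul hu₁).sub (contDiff_sin_coord.mul hu₀)
  let F : Fin 3 → (Fin 3 → ℝ) → ℝ := ![
    fun q => W q * u₁ q - Real.cos (q 2) * tanWeight c W q,
    fun q => (-1) * (W q * u₀ q) - Real.sin (q 2) * tanWeight c W q,
    fun q => lineDerivField u q * Y q]
  have hF : ∀ i, ContDiff ℝ (⊤ : ℕ∞) (F i) := by
    intro i
    fin_cases i
    · exact (hW.mul hu₁).sub (contDiff_cos_coord.mul hT)
    · exact (contDiff_const.mul (hW.mul hu₀)).sub (contDiff_sin_coord.mul hT)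
    · exact hX.mul hY
  have hF0 : ∀ i q, R ^ 2 < q 0 ^ 2 + q 1 ^ 2 → F i q = 0 := by
    intro i q hq
    fin_cases i
    · simp [F, hW0 q hq, tanWeight]
    · simp [F, hW0 q hq, tanWeight]
    · simp [F, lineDerivField_eq_zero_outside hu0 q hq]
  have hFper : ∀ q, F 2 (q + Pi.single 2 (2 * Real.pi)) = F 2 q := by
    intro q
    simp [F, Y, lineDerivField, hu₀def, hu₁def, partialDeriv_add_period hper]
  have hint := sum_partialDeriv_integral_eq_zero hR hF hF0 hFper
  have hbound : ∀ q, lineDerivField u q ^ 2 ≤ -∑ i, partialDeriv i (F i) q := by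
    intro q
    have d0 : ∀ i, partialDeriv i (fun q => Real.cos (q 2) * tanWeight c W q) q = _ := fun i =>
      partialDeriv_mul i (contDiff_cos_coord.differentiableAt_top q) (hT.differentiableAt_top q)
    have d1 : ∀ i, partialDeriv i (fun q => Real.sin (q 2) * tanWeight c W q) q = _ := fun i =>
      partialDeriv_mul i (contDiff_sin_coord.differentiableAt_top q) (hT.differentiableAt_top q)
    have d2 : ∀ i, partialDeriv i (fun q => W q * u₁ q) q = _ := fun i =>
      partialDeriv_mul i (hW.differentiableAt_top q) (hu₁.differentiableAt_top q)
    have d3 : ∀ i, partialDeriv i (fun q => W q * u₀ q) q = _ := fun i =>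
      partialDeriv_mul i (hW.differentiableAt_top q) (hu₀.differentiableAt_top q)
    have d3' : ∀ i, partialDeriv i (fun q => (-1) * (W q * u₀ q)) q = _ := fun i =>
      partialDeriv_mul i (differentiableAt_const _) ((hW.mul hu₀).differentiableAt_top q)
    have e0 : partialDeriv 0 (F 0) q = _ := partialDeriv_sub 0
      ((hW.mul hu₁).differentiableAt_top q) ((contDiff_cos_coord.mul hT).differentiableAt_top q)
    have e1 : partialDeriv 1 (F 1) q = _ := partialDeriv_sub 1
      ((contDiff_const.mul (hW.mul hu₀)).differentiableAt_top q)
      ((contDiff_sin_coord.mul hT).differentiableAt_top q)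
    have e2 : partialDeriv 2 (F 2) q = _ := partialDeriv_mul 2
      (hX.differentiableAt_top q) (hY.differentiableAt_top q)
    have y2 : partialDeriv 2 Y q = _ := partialDeriv_sub 2
      ((contDiff_cos_coord.mul hu₁).differentiableAt_top q)
      ((contDiff_sin_coord.mul hu₀).differentiableAt_top q)
    have c0 : partialDeriv 2 (fun q => Real.cos (q 2) * u₀ q) q = _ :=
      partialDeriv_mul 2 (contDiff_cos_coord.differentiableAt_top q) (hu₀.differentiableAt_top q)
    have c1 : partialDeriv 2 (fun q => Real.cos (q 2) * u₁ q) q = _ :=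
      partialDeriv_mul 2 (contDiff_cos_coord.differentiableAt_top q) (hu₁.differentiableAt_top q)
    have s0 : partialDeriv 2 (fun q => Real.sin (q 2) * u₀ q) q = _ :=
      partialDeriv_mul 2 (contDiff_sin_coord.differentiableAt_top q) (hu₀.differentiableAt_top q)
    have s1 : partialDeriv 2 (fun q => Real.sin (q 2) * u₁ q) q = _ :=
      partialDeriv_mul 2 (contDiff_sin_coord.differentiableAt_top q) (hu₁.differentiableAt_top q)
    have x2 : partialDeriv 2 (lineDerivField u) q = _ := partialDeriv_add 2
      ((contDiff_cos_coord.mul hu₀).differentiableAt_top q)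
      ((contDiff_sin_coord.mul hu₁).differentiableAt_top q)
    have k0 : partialDeriv 2 u₀ q = partialDeriv 0 W q := partialDeriv_comm hu 2 0 q
    have k1 : partialDeriv 2 u₁ q = partialDeriv 1 W q := partialDeriv_comm hu 2 1 q
    have k2 : partialDeriv 0 u₁ q = partialDeriv 1 u₀ q := partialDeriv_comm hu 0 1 q
    have tri := Real.sin_sq_add_cos_sq (q 2)
    have hVq := hV q
    rw [x2, c0, s1, partialDeriv_cos, partialDeriv_sin, k0, k1] at hVq
    rw [Fin.sum_univ_three, e0, e1, e2, y2, d0, d1, d2, d3', d3, c1, s0, hV q,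
      partialDeriv_tanWeight hR hc hcR hW hW0,
      partialDeriv_tanWeight hR hc hcR hW hW0, partialDeriv_cos, partialDeriv_sin,
      partialDeriv_cos, partialDeriv_sin, (partialDeriv_lineCoord q).1,
      (partialDeriv_lineCoord q).2, k0, k1, k2]
    have hconst : partialDeriv 1 (fun _ => (-1 : ℝ)) q = 0 := by simp [partialDeriv]
    rw [hconst]
    simp only [lineDerivField, Y, if_true, ← hu₀def, ← hu₁def] at hVq ⊢
    have h02 : (0 : Fin 3) ≠ 2 := by decide
    have h12 : (1 : Fin 3) ≠ 2 := by decide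
    rw [if_neg h02, if_neg h12]
    have hAq : A q ^ 2 ≤ c ^ 2 := sq_le_sq.2 (by rw [abs_of_nonneg hc]; exact hA q)
    have hWA : 0 ≤ (c ^ 2 - A q ^ 2) * W q ^ 2 := mul_nonneg (by linarith) (sq_nonneg _)
    generalize c * Real.tan (c * lineCoord q) = h at *
    generalize partialDeriv 0 W q = W₀ at *
    generalize partialDeriv 1 W q = W₁ at *
    generalize Real.cos (q 2) = C at *
    generalize Real.sin (q 2) = S at *
    have key : 0 ≤ ((C * W₀ + S * W₁) + h * W q) ^ 2 := sq_nonneg _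
    linear_combination hWA + key - ((A q * W q - (C * W₀ + S * W₁)) * hVq) -
      (W₀ * u₁ q - W₁ * u₀ q + (c ^ 2 + h ^ 2) * W q ^ 2) * tri
  rcases lt_or_ge (R ^ 2) (p 0 ^ 2 + p 1 ^ 2) with hp | hp
  · exact lineDerivField_eq_zero_outside hu0 p hp
  have hXc : Continuous fun q => lineDerivField u q ^ 2 := hX.continuous.pow 2
  have hcont : Continuous fun q => ∑ i, partialDeriv i (F i) q :=
    continuous_finsetSum _ fun i _ => ((hF i).partialDeriv i).continuous
  set lo : Fin 3 → ℝ := ![-(R + 1), -(R + 1), 0]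
  set hi : Fin 3 → ℝ := ![R + 1, R + 1, 2 * Real.pi]
  have hle : ∫ q in Set.Icc lo hi, lineDerivField u q ^ 2 ≤ 0 := by
    calc ∫ q in Set.Icc lo hi, lineDerivField u q ^ 2
        ≤ ∫ q in Set.Icc lo hi, -∑ i, partialDeriv i (F i) q :=
          MeasureTheory.integral_mono hXc.integrableOn_Icc hcont.neg.integrableOn_Icc hbound
      _ = 0 := by rw [MeasureTheory.integral_neg, hint, neg_zero]
  have hzero : ∫ q in Set.Icc lo hi, lineDerivField u q ^ 2 = 0 :=
    le_antisymm hle (MeasureTheory.integral_nonneg fun q => sq_nonneg _)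
  have hae := (MeasureTheory.integral_eq_zero_iff_of_nonneg (fun q => sq_nonneg _)
    hXc.integrableOn_Icc).1 hzero
  let U : Set (Fin 3 → ℝ) := Set.pi Set.univ fun i => Set.Ioo (lo i) (hi i)
  have hUsub : U ⊆ Set.Icc lo hi := fun q hq =>
    ⟨fun i => (hq i trivial).1.le, fun i => (hq i trivial).2.le⟩
  have hUo : IsOpen U := isOpen_set_pi Set.finite_univ fun i _ => isOpen_Ioo
  have hEq := MeasureTheory.Measure.eqOn_open_of_ae_eq
    (MeasureTheory.ae_restrict_of_ae_restrict_of_subset hUsub hae) hUo hXc.continuousOn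
    continuousOn_const
  have hpU : p ∈ U := by
    intro i _
    have h0 := abs_lt.1 (abs_lt_of_sq_lt_sq (a := p 0) (b := R + 1)
      (by nlinarith [sq_nonneg (p 1)]) (by linarith))
    have h1 := abs_lt.1 (abs_lt_of_sq_lt_sq (a := p 1) (b := R + 1)
      (by nlinarith [sq_nonneg (p 0)]) (by linarith))
    fin_cases i
    · exact h0
    · exact h1
    · exact ⟨hp0, hp1⟩
  exact pow_eq_zero_iff two_ne_zero |>.1 (hEq hpU)

theorem contDiff_primitive_of_contDiff {H : Type} [NormedAddCommGroup H] [NormedSpace ℝ H]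
    [ProperSpace H] {g : H × ℝ → ℝ} (hg : ContDiff ℝ (⊤ : ℕ∞) g) :
    ContDiff ℝ (⊤ : ℕ∞) fun z : H × ℝ => ∫ s in (0 : ℝ)..z.2, g (z.1, s) := by
  have h : (fun z : H × ℝ => ∫ s in (0 : ℝ)..z.2, g (z.1, s)) =
      fun z => z.2 * ∫ s in (0 : ℝ)..1, g (z.1, z.2 * s) := by
    funext z
    have := intervalIntegral.smul_integral_comp_mul_left (a := 0) (b := 1)
      (fun s => g (z.1, s)) z.2
    simpa using this.symm
  rw [h]
  exact contDiff_snd.mul (contDiff_parametric_unitInterval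
    (g := fun w : (H × ℝ) × ℝ => g (w.1.1, w.1.2 * w.2)) (hg.comp (by fun_prop)))

/-- The point at arclength `t` along the ray from `(p 0, p 1)` with direction angle `p 2`. -/
def rayPoint (p : Fin 3 → ℝ) (t : ℝ) : ℝ × ℝ :=
  (p 0 + t * Real.cos (p 2), p 1 + t * Real.sin (p 2))

/-- The integrand of the attenuated X-ray transform along a ray. -/
def attenuatedRay (a f : ℝ × ℝ → ℝ) (p : Fin 3 → ℝ) (t : ℝ) : ℝ :=
  f (rayPoint p t) * Real.exp (∫ s in (0 : ℝ)..t, a (rayPoint p s))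

/-- The solution of the transport equation `X u + a u = -f` given by integration along rays. -/
def transportSol (R : ℝ) (a f : ℝ × ℝ → ℝ) (p : Fin 3 → ℝ) : ℝ :=
  ∫ t in (0 : ℝ)..(R - lineCoord p), attenuatedRay a f p t

theorem contDiff_rayPoint :
    ContDiff ℝ (⊤ : ℕ∞) fun z : (Fin 3 → ℝ) × ℝ => rayPoint z.1 z.2 := by
  unfold rayPoint
  fun_prop

theorem contDiff_attenuatedRay {a f : ℝ × ℝ → ℝ} (ha : ContDiff ℝ (⊤ : ℕ∞) a)
    (hf : ContDiff ℝ (⊤ : ℕ∞) f) :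
    ContDiff ℝ (⊤ : ℕ∞) fun z : (Fin 3 → ℝ) × ℝ => attenuatedRay a f z.1 z.2 :=
  (hf.comp contDiff_rayPoint).mul
    (contDiff_primitive_of_contDiff (ha.comp contDiff_rayPoint)).exp

theorem contDiff_transportSol (R : ℝ) {a f : ℝ × ℝ → ℝ} (ha : ContDiff ℝ (⊤ : ℕ∞) a)
    (hf : ContDiff ℝ (⊤ : ℕ∞) f) : ContDiff ℝ (⊤ : ℕ∞) (transportSol R a f) :=
  (contDiff_primitive_of_contDiff (contDiff_attenuatedRay ha hf)).comp
    (contDiff_id.prodMk (contDiff_const.sub contDiff_lineCoord))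

theorem rayPoint_norm_sq (p : Fin 3 → ℝ) (t : ℝ) :
    (rayPoint p t).1 ^ 2 + (rayPoint p t).2 ^ 2 =
      p 0 ^ 2 + p 1 ^ 2 + 2 * t * lineCoord p + t ^ 2 := by
  simp only [rayPoint, lineCoord]
  linear_combination t ^ 2 * Real.sin_sq_add_cos_sq (p 2)

theorem attenuatedRay_eq_zero {R : ℝ} {a f : ℝ × ℝ → ℝ}
    (hf0 : ∀ z : ℝ × ℝ, R ^ 2 < z.1 ^ 2 + z.2 ^ 2 → f z = 0) {p : Fin 3 → ℝ} {t : ℝ}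
    (h : R ^ 2 < p 0 ^ 2 + p 1 ^ 2 + 2 * t * lineCoord p + t ^ 2) :
    attenuatedRay a f p t = 0 := by
  rw [attenuatedRay, hf0 _ (by rwa [rayPoint_norm_sq]), zero_mul]

theorem transportSol_eq_zero {R : ℝ} (hR : 0 < R) {a f : ℝ × ℝ → ℝ}
    (hf0 : ∀ z : ℝ × ℝ, R ^ 2 < z.1 ^ 2 + z.2 ^ 2 → f z = 0)
    (hvan : ∀ p, ∫ t, attenuatedRay a f p t = 0) (p : Fin 3 → ℝ)
    (hp : R ^ 2 < p 0 ^ 2 + p 1 ^ 2) : transportSol R a f p = 0 := by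
  have hl := lineCoord_sq_le p
  have hfar : ∀ t, R - lineCoord p < t → attenuatedRay a f p t = 0 := fun t ht =>
    attenuatedRay_eq_zero hf0 (by nlinarith)
  rcases lt_or_ge (lineCoord p) 0 with h | h
  · rw [transportSol, intervalIntegral.integral_eq_integral_of_support_subset, hvan]
    intro t ht
    by_contra hcon
    refine ht ?_
    rcases le_or_gt t 0 with h0 | h0
    · exact attenuatedRay_eq_zero hf0 (by nlinarith [mul_nonneg_of_nonpos_of_nonpos h0 h.le])
    · exact hfar t (lt_of_not_ge fun h1 => hcon ⟨h0, h1⟩)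
  · rw [transportSol]
    rcases le_total 0 (R - lineCoord p) with h0 | h0
    · rw [intervalIntegral.integral_of_le h0]
      exact MeasureTheory.setIntegral_eq_zero_of_forall_eq_zero fun t ht =>
        attenuatedRay_eq_zero hf0 (by nlinarith [mul_nonneg ht.1.le h])
    · rw [intervalIntegral.integral_of_ge h0, neg_eq_zero]
      exact MeasureTheory.setIntegral_eq_zero_of_forall_eq_zero fun t ht => hfar t ht.1

theorem transportSol_add_period (R : ℝ) (a f : ℝ × ℝ → ℝ) (p : Fin 3 → ℝ) :
    transportSol R a f (p + Pi.single 2 (2 * Real.pi)) = transportSol R a f p := by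
  simp [transportSol, attenuatedRay, rayPoint, lineCoord]

theorem lineDerivField_transportSol (R : ℝ) {a f : ℝ × ℝ → ℝ} (ha : ContDiff ℝ (⊤ : ℕ∞) a)
    (hf : ContDiff ℝ (⊤ : ℕ∞) f) (p : Fin 3 → ℝ) :
    lineDerivField (transportSol R a f) p =
      -(a (p 0, p 1) * transportSol R a f p) - f (p 0, p 1) := by
  set v : Fin 3 → ℝ := Real.cos (p 2) • Pi.single 0 1 + Real.sin (p 2) • Pi.single 1 1 with hv
  have hu := contDiff_transportSol R ha hf
  have hfd : HasDerivAt (fun r : ℝ => transportSol R a f (p + r • v))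
      (lineDerivField (transportSol R a f) p) 0 := by
    have h1 : HasFDerivAt (transportSol R a f) (fderiv ℝ (transportSol R a f) p)
        (p + (0 : ℝ) • v) := by
      simpa using (hu.differentiableAt_top p).hasFDerivAt
    have h2 : HasDerivAt (fun r : ℝ => p + r • v) v 0 := by
      simpa using ((hasDerivAt_id (0 : ℝ)).smul_const v).const_add p
    have h3 := h1.comp_hasDerivAt (0 : ℝ) h2
    have h4 : fderiv ℝ (transportSol R a f) p v = lineDerivField (transportSol R a f) p := by
      simp [lineDerivField, partialDeriv, hv]
    rwa [h4] at h3
  have hv0 : v 0 = Real.cos (p 2) := by simp [hv]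
  have hv1 : v 1 = Real.sin (p 2) := by simp [hv]
  have hv2 : v 2 = 0 := by simp [hv]
  have hray : ∀ r t, rayPoint (p + r • v) t = rayPoint p (t + r) := by
    intro r t
    simp only [rayPoint, Pi.add_apply, Pi.smul_apply, hv0, hv1, hv2, smul_eq_mul, mul_zero,
      add_zero]
    ext <;> ring
  have hline : ∀ r, lineCoord (p + r • v) = lineCoord p + r := by
    intro r
    simp only [lineCoord, Pi.add_apply, Pi.smul_apply, hv0, hv1, hv2, smul_eq_mul, mul_zero,
      add_zero]
    linear_combination r * Real.sin_sq_add_cos_sq (p 2)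
  have hac : Continuous fun s => a (rayPoint p s) :=
    (ha.continuous.comp contDiff_rayPoint.continuous).comp (Continuous.prodMk_right p)
  have hgc : Continuous fun t => attenuatedRay a f p t :=
    (contDiff_attenuatedRay ha hf).continuous.comp (Continuous.prodMk_right p)
  have hatt : ∀ r t, attenuatedRay a f (p + r • v) t =
      Real.exp (-∫ s in (0 : ℝ)..r, a (rayPoint p s)) * attenuatedRay a f p (t + r) := by
    intro r t
    simp only [attenuatedRay, hray]
    rw [intervalIntegral.integral_comp_add_right (fun s => a (rayPoint p s)), zero_add,
      ← intervalIntegral.integral_add_adjacent_intervals (hac.intervalIntegrable 0 r)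
        (hac.intervalIntegrable r (t + r)), Real.exp_add, Real.exp_neg]
    field_simp
  have hsol : (fun r : ℝ => transportSol R a f (p + r • v)) = fun r =>
      Real.exp (-∫ s in (0 : ℝ)..r, a (rayPoint p s)) *
        ∫ t in r..(R - lineCoord p), attenuatedRay a f p t := by
    funext r
    simp only [transportSol, hatt, hline]
    rw [intervalIntegral.integral_const_mul,
      intervalIntegral.integral_comp_add_right (fun t => attenuatedRay a f p t)]
    congr 2 <;> ring
  have hd1 : HasDerivAt (fun r => ∫ s in (0 : ℝ)..r, a (rayPoint p s)) (a (rayPoint p 0)) 0 :=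
    intervalIntegral.integral_hasDerivAt_right (hac.intervalIntegrable _ _)
      (hac.stronglyMeasurableAtFilter _ _) hac.continuousAt
  have hd2 : HasDerivAt (fun r => ∫ t in r..(R - lineCoord p), attenuatedRay a f p t)
      (-attenuatedRay a f p 0) 0 :=
    intervalIntegral.integral_hasDerivAt_left (hgc.intervalIntegrable _ _)
      (hgc.stronglyMeasurableAtFilter _ _) hgc.continuousAt
  have hd := hd1.neg.exp.mul hd2
  rw [hsol] at hfd
  rw [hfd.unique hd]
  simp [attenuatedRay, rayPoint, transportSol]
  ring

/-- Injectivity of the attenuated X-ray transform in the plane. -/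
theorem eq_zero_of_attenuatedRay_integral_eq_zero {R c : ℝ} (hR : 0 < R) (hc : 0 ≤ c)
    (hcR : c * R < Real.pi / 2) {a f : ℝ × ℝ → ℝ} (ha : ContDiff ℝ (⊤ : ℕ∞) a)
    (hf : ContDiff ℝ (⊤ : ℕ∞) f) (hac : ∀ z, |a z| ≤ c)
    (hf0 : ∀ z : ℝ × ℝ, R ^ 2 < z.1 ^ 2 + z.2 ^ 2 → f z = 0)
    (hvan : ∀ p, ∫ t, attenuatedRay a f p t = 0) (z : ℝ × ℝ) : f z = 0 := by
  set u := transportSol R a f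
  have hu : ContDiff ℝ (⊤ : ℕ∞) u := contDiff_transportSol R ha hf
  have hu0 : ∀ p, R ^ 2 < p 0 ^ 2 + p 1 ^ 2 → u p = 0 := transportSol_eq_zero hR hf0 hvan
  have hX : ∀ p, lineDerivField u p = -(a (p 0, p 1) * u p) - f (p 0, p 1) :=
    lineDerivField_transportSol R ha hf
  have hproj : ContDiff ℝ (⊤ : ℕ∞) fun q : Fin 3 → ℝ => (q 0, q 1) := by fun_prop
  have hflat : ∀ {g : ℝ × ℝ → ℝ}, ContDiff ℝ (⊤ : ℕ∞) g → ∀ p : Fin 3 → ℝ,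
      partialDeriv 2 (fun q => g (q 0, q 1)) p = 0 := by
    intro g hg p
    have h1 : HasFDerivAt (fun q : Fin 3 → ℝ => (q 0, q 1)) _ p :=
      (hasFDerivAt_coord 0 p).prodMk (hasFDerivAt_coord 1 p)
    have h2 : HasFDerivAt (fun q : Fin 3 → ℝ => g (q 0, q 1)) _ p :=
      HasFDerivAt.comp (g := g) p (hg.differentiable (by norm_num) (p 0, p 1)).hasFDerivAt h1
    rw [partialDeriv, h2.fderiv]
    have h0 : (fderiv ℝ g (p 0, p 1)) (0, 0) = 0 := map_zero _
    simpa using h0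
  have hV : ∀ p, partialDeriv 2 (lineDerivField u) p = -a (p 0, p 1) * partialDeriv 2 u p := by
    intro p
    have ha' : ContDiff ℝ (⊤ : ℕ∞) fun q : Fin 3 → ℝ => a (q 0, q 1) := ha.comp hproj
    have hf' : ContDiff ℝ (⊤ : ℕ∞) fun q : Fin 3 → ℝ => f (q 0, q 1) := hf.comp hproj
    have hfun : lineDerivField u =
        fun q => (-1) * (a (q 0, q 1) * u q) - f (q 0, q 1) := by
      funext q
      rw [hX q]
      ring
    have hconst : partialDeriv 2 (fun _ => (-1 : ℝ)) p = 0 := by simp [partialDeriv]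
    rw [hfun, partialDeriv_sub 2
        ((contDiff_const.mul (ha'.mul hu)).differentiableAt_top p) (hf'.differentiableAt_top p),
      partialDeriv_mul 2 (differentiableAt_const _) ((ha'.mul hu).differentiableAt_top p),
      partialDeriv_mul 2 (ha'.differentiableAt_top p) (hu.differentiableAt_top p),
      hflat ha, hflat hf, hconst]
    ring
  have hX0 := lineDerivField_eq_zero hR hc hcR (A := fun p => a (p 0, p 1)) hu hu0
    (transportSol_add_period R a f) (fun p => hac _) hV
  have hpi : ∀ t : ℝ, lineDerivField u ![t, z.2, Real.pi] = 0 := fun t =>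
    hX0 _ Real.pi_pos (by change Real.pi < 2 * Real.pi; linarith [Real.pi_pos])
  have hder : ∀ t : ℝ, HasDerivAt (fun t : ℝ => u ![t, z.2, Real.pi]) 0 t := by
    intro t
    have h1 : HasDerivAt (fun t : ℝ => (![t, z.2, Real.pi] : Fin 3 → ℝ)) (Pi.single 0 1) t := by
      refine hasDerivAt_pi.2 fun i => ?_
      fin_cases i
      · simpa using hasDerivAt_id' t
      · simpa using hasDerivAt_const t z.2
      · simpa using hasDerivAt_const t Real.pi
    have h2 := (hu.differentiableAt_top ![t, z.2, Real.pi]).hasFDerivAt.comp_hasDerivAt t h1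
    have h3 : partialDeriv 0 u ![t, z.2, Real.pi] = 0 := by
      simpa [lineDerivField] using hpi t
    rw [partialDeriv] at h3
    rwa [h3] at h2
  have hconst := is_const_of_deriv_eq_zero (fun t => (hder t).differentiableAt)
    (fun t => (hder t).deriv) z.1 (R + 1)
  have hend : u ![R + 1, z.2, Real.pi] = 0 :=
    hu0 _ (by change R ^ 2 < (R + 1) ^ 2 + z.2 ^ 2; nlinarith [sq_nonneg z.2])
  have hz : u ![z.1, z.2, Real.pi] = 0 := hconst.trans hend
  have := hX ![z.1, z.2, Real.pi]
  rw [hpi, hz] at this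
  simpa using this

theorem exists_unit_orthogonal {n : ℕ} (hn : 2 ≤ n) (x : EuclideanSpace ℝ (Fin n)) :
    ∃ e₁ e₂ : EuclideanSpace ℝ (Fin n),
      ‖e₁‖ = 1 ∧ ‖e₂‖ = 1 ∧ inner ℝ e₁ e₂ = 0 ∧ x = ‖x‖ • e₁ := by
  have : Nontrivial (EuclideanSpace ℝ (Fin n)) :=
    Module.nontrivial_of_finrank_pos (R := ℝ) (by rw [finrank_euclideanSpace_fin]; omega)
  obtain ⟨e₁, he₁, hx⟩ : ∃ e₁ : EuclideanSpace ℝ (Fin n), ‖e₁‖ = 1 ∧ x = ‖x‖ • e₁ := by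
    rcases eq_or_ne x 0 with rfl | hx
    · obtain ⟨e, he⟩ := exists_norm_eq (EuclideanSpace ℝ (Fin n)) zero_le_one
      exact ⟨e, he, by simp⟩
    · exact ⟨‖x‖⁻¹ • x, norm_smul_inv_norm hx, (smul_inv_smul₀ (norm_ne_zero_iff.2 hx) x).symm⟩
  have hrank : 0 < Module.finrank ℝ (ℝ ∙ e₁)ᗮ := by
    have h := Submodule.finrank_add_finrank_orthogonal (ℝ ∙ e₁)
    rw [finrank_span_singleton (by rintro rfl; simp at he₁), finrank_euclideanSpace_fin] at h
    omega
  have := Module.nontrivial_of_finrank_pos hrank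
  obtain ⟨e₂, he₂⟩ := exists_norm_eq (ℝ ∙ e₁)ᗮ zero_le_one
  exact ⟨e₁, e₂, he₁, he₂, Submodule.mem_orthogonal_singleton_iff_inner_right.1 e₂.2, hx⟩

theorem norm_sq_orthonormal_comb {E : Type*} [NormedAddCommGroup E] [InnerProductSpace ℝ E]
    {e₁ e₂ : E} (h₁ : ‖e₁‖ = 1) (h₂ : ‖e₂‖ = 1) (h : inner ℝ e₁ e₂ = 0) (s t : ℝ) :
    ‖s • e₁ + t • e₂‖ ^ 2 = s ^ 2 + t ^ 2 := by
  rw [norm_add_sq_real, inner_smul_left, inner_smul_right, h, norm_smul, norm_smul, h₁, h₂]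
  simp

theorem statement17 {n : ℕ} (hn : 2 ≤ n) (R : ℝ) (hR : 0 < R)
    (a f : EuclideanSpace ℝ (Fin n) → ℝ)
    (ha : ContDiff ℝ (⊤ : ℕ∞) a) (hf : ContDiff ℝ (⊤ : ℕ∞) f)
    (hsa : tsupport a ⊆ Metric.closedBall 0 R)
    (hsf : tsupport f ⊆ Metric.closedBall 0 R)
    (hsmall : ∀ x, |a x| < Real.pi / (2 * R))
    (hvanish : ∀ x θ : EuclideanSpace ℝ (Fin n), ‖θ‖ = 1 →
      (∫ t : ℝ, f (x + t • θ) * Real.exp (∫ s in (0 : ℝ)..t, a (x + s • θ))) = 0) :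
    ∀ x, f x = 0 := by
  intro x
  obtain ⟨e₁, e₂, he₁, he₂, he, hx⟩ := exists_unit_orthogonal hn x
  have hcpt : HasCompactSupport fun y => |a y| :=
    HasCompactSupport.comp_left (g := fun r : ℝ => |r|)
      (HasCompactSupport.of_support_subset_isCompact (isCompact_closedBall 0 R)
        ((subset_tsupport a).trans hsa)) abs_zero
  obtain ⟨y₀, hy₀⟩ := ha.continuous.abs.exists_forall_ge_of_hasCompactSupport hcpt
  have hcR : |a y₀| * R < Real.pi / 2 := by
    have h := mul_lt_mul_of_pos_right (hsmall y₀) hR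
    have h' : Real.pi / (2 * R) * R = Real.pi / 2 := by field_simp
    rwa [h'] at h
  let L : ℝ × ℝ → EuclideanSpace ℝ (Fin n) := fun z => z.1 • e₁ + z.2 • e₂
  have hL : ContDiff ℝ (⊤ : ℕ∞) L := by fun_prop
  have hLsq : ∀ z, ‖L z‖ ^ 2 = z.1 ^ 2 + z.2 ^ 2 := fun z =>
    norm_sq_orthonormal_comb he₁ he₂ he z.1 z.2
  have hf0 : ∀ z : ℝ × ℝ, R ^ 2 < z.1 ^ 2 + z.2 ^ 2 → f (L z) = 0 := by
    intro z hz
    refine image_eq_zero_of_notMem_tsupport fun hmem => ?_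
    have h := mem_closedBall_zero_iff.1 (hsf hmem)
    rw [← hLsq] at hz
    nlinarith [norm_nonneg (L z)]
  have hray : ∀ (p : Fin 3 → ℝ) (t : ℝ), L (rayPoint p t) =
      L (p 0, p 1) + t • L (Real.cos (p 2), Real.sin (p 2)) := by
    intro p t
    simp only [L, rayPoint]
    module
  have hvan : ∀ p, ∫ t, attenuatedRay (fun z => a (L z)) (fun z => f (L z)) p t = 0 := by
    intro p
    simp only [attenuatedRay, hray]
    refine hvanish _ _ ?_
    have h := hLsq (Real.cos (p 2), Real.sin (p 2))
    rw [Real.cos_sq_add_sin_sq] at h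
    exact (pow_eq_one_iff_of_nonneg (norm_nonneg _) two_ne_zero).1 h
  have hmain := eq_zero_of_attenuatedRay_integral_eq_zero hR (abs_nonneg (a y₀)) hcR
    (ha.comp hL) (hf.comp hL) (fun z => hy₀ (L z)) hf0 hvan (‖x‖, 0)
  have hLx : L (‖x‖, 0) = x := by
    simp only [L, zero_smul, add_zero]
    exact hx.symm
  simpa [hLx] using hmain
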